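/- Let Ψ : c00 → c00 and Φ : c00 → c00 be homogeneous maps that commute with all sign sequences, i.e., f(ε·x) = ε·f(x) for every ε ∈ {−1,1}^ℕ and x ∈ c00. Suppose there exist a homogeneous map H : c00 → ℓ₂ and a constant K such that ‖H(x+x') − H(x) − H(x') − Φ(Ψ(x+x') − Ψ(x) − Ψ(x'))‖₂ ≤ K(‖x‖₂ + ‖x'‖₂) for all x, x' ∈ c00. Then there exists a homogeneous map H̃ : c00 → ℓ₂ which commutes with all sign sequences (and in particular is support-preserving) and satisfies the same inequality with the same constant K: ‖H̃(x+x') − H̃(x) − H̃(x') − Φ(Ψ(x+x') − Ψ(x) − Ψ(x'))‖₂ ≤ K(‖x‖₂ + ‖x'‖₂) for all x, x' ∈ c00. -/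

import Mathlib

/-- `x : ℕ → ℝ` is finitely supported (i.e. belongs to `c00`). -/
def FinSupp (x : ℕ → ℝ) : Prop := (Function.support x).Finite

/-- The `ℓ₂` norm of a sequence, `‖x‖₂ = (∑ₙ |x n|²)^{1/2}`. -/
noncomputable def l2Norm (x : ℕ → ℝ) : ℝ := Real.sqrt (∑' n, (x n) ^ 2)

/-- `ε : ℕ → ℝ` is a sign sequence, i.e. an element of `{−1,1}^ℕ`. -/
def IsSign (ε : ℕ → ℝ) : Prop := ∀ n, ε n = 1 ∨ ε n = -1

open Finset

/-- The sign sequence equal to `-1` exactly on the finite set `S`. -/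
def signOf (S : Finset ℕ) : ℕ → ℝ := fun n => if n ∈ S then -1 else 1

theorem isSign_signOf (S : Finset ℕ) : IsSign (signOf S) := by
  intro n
  unfold signOf
  split_ifs <;> simp

theorem IsSign.mul_self {ε : ℕ → ℝ} (hε : IsSign ε) (n : ℕ) : ε n * ε n = 1 := by
  rcases hε n with h | h <;> simp [h]

theorem IsSign.sq {ε : ℕ → ℝ} (hε : IsSign ε) (n : ℕ) : ε n ^ 2 = 1 := by
  rw [_root_.sq, hε.mul_self]

theorem l2Norm_sign_mul {ε : ℕ → ℝ} (hε : IsSign ε) (x : ℕ → ℝ) :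
    l2Norm (ε * x) = l2Norm x := by
  simp [l2Norm, mul_pow, hε.sq]

theorem FinSupp.add {x y : ℕ → ℝ} (hx : FinSupp x) (hy : FinSupp y) : FinSupp (x + y) :=
  (hx.union hy).subset (Function.support_add x y)

theorem FinSupp.sub {x y : ℕ → ℝ} (hx : FinSupp x) (hy : FinSupp y) : FinSupp (x - y) :=
  (hx.union hy).subset (Function.support_sub x y)

theorem FinSupp.mul_left {x : ℕ → ℝ} (hx : FinSupp x) (ε : ℕ → ℝ) : FinSupp (ε * x) :=
  hx.subset (Function.support_mul_subset_right ε x)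

theorem FinSupp.const_smul {x : ℕ → ℝ} (hx : FinSupp x) (c : ℝ) : FinSupp (c • x) :=
  hx.subset (Function.support_const_smul_subset c x)

theorem FinSupp.summable_sq {x : ℕ → ℝ} (hx : FinSupp x) : Summable fun n => x n ^ 2 :=
  summable_of_hasFiniteSupport (hx.subset fun n hn h => hn (by simp [h]))

theorem summable_sq_sub {x y : ℕ → ℝ} (hx : Summable fun n => x n ^ 2)
    (hy : Summable fun n => y n ^ 2) : Summable fun n => (x n - y n) ^ 2 := by
  refine Summable.of_nonneg_of_le (fun n => sq_nonneg _) (fun n => ?_)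
    ((hx.mul_left 2).add (hy.mul_left 2))
  nlinarith [sq_nonneg (x n + y n)]

/-- A map commuting with sign sequences is support-preserving. -/
theorem apply_eq_zero_of_sign_equivariant {f : (ℕ → ℝ) → ℕ → ℝ}
    (hf : ∀ ε x : ℕ → ℝ, IsSign ε → FinSupp x → f (ε * x) = ε * f x)
    {x : ℕ → ℝ} (hx : FinSupp x) {n : ℕ} (hn : x n = 0) : f x n = 0 := by
  have h := hf (signOf {n}) x (isSign_signOf _) hx
  have hfix : signOf {n} * x = x := by
    ext m
    by_cases hm : m = n
    · subst hm; simp [hn]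
    · simp [signOf, hm]
  rw [hfix] at h
  have := congrFun h n
  simp only [Pi.mul_apply, signOf, mem_singleton, if_true] at this
  linarith

/-- A sequence dominated by an average of elements of a ball of `ℓ₂` lies in that ball. -/
theorem l2Norm_le_of_abs_le_average {ι : Type*} (s : Finset ι) (hs : s.Nonempty)
    (f : ι → ℕ → ℝ) (v : ℕ → ℝ) (C : ℝ) (hf : ∀ i ∈ s, Summable fun n => f i n ^ 2)
    (hC : ∀ i ∈ s, l2Norm (f i) ≤ C)
    (hv : ∀ n, |v n| ≤ |(s.card : ℝ)⁻¹ * ∑ i ∈ s, f i n|) : l2Norm v ≤ C := by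
  have hcard : (0 : ℝ) < s.card := by exact_mod_cast hs.card_pos
  have hC0 : 0 ≤ C := by
    obtain ⟨i, hi⟩ := hs
    exact (Real.sqrt_nonneg _).trans (hC i hi)
  have hpt : ∀ n, v n ^ 2 ≤ (s.card : ℝ)⁻¹ * ∑ i ∈ s, f i n ^ 2 := by
    intro n
    refine (sq_le_sq.mpr (hv n)).trans ?_
    have h := sq_sum_le_card_mul_sum_sq (s := s) (f := fun i => f i n)
    calc ((s.card : ℝ)⁻¹ * ∑ i ∈ s, f i n) ^ 2
        = (s.card : ℝ)⁻¹ ^ 2 * (∑ i ∈ s, f i n) ^ 2 := mul_pow _ _ _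
      _ ≤ (s.card : ℝ)⁻¹ ^ 2 * (s.card * ∑ i ∈ s, f i n ^ 2) := by gcongr
      _ = (s.card : ℝ)⁻¹ * ∑ i ∈ s, f i n ^ 2 := by field_simp
  have hsum : Summable fun n => (s.card : ℝ)⁻¹ * ∑ i ∈ s, f i n ^ 2 :=
    (summable_sum hf).mul_left _
  refine Real.sqrt_le_iff.mpr ⟨hC0, ?_⟩
  calc ∑' n, v n ^ 2 ≤ ∑' n, (s.card : ℝ)⁻¹ * ∑ i ∈ s, f i n ^ 2 :=
        (Summable.of_nonneg_of_le (fun n => sq_nonneg _) hpt hsum).tsum_le_tsum hpt hsum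
    _ = (s.card : ℝ)⁻¹ * ∑ i ∈ s, ∑' n, f i n ^ 2 := by
        rw [tsum_mul_left, Summable.tsum_finsetSum hf]
    _ ≤ (s.card : ℝ)⁻¹ * ∑ _i ∈ s, C ^ 2 := by
        gcongr with i hi
        exact (Real.sqrt_le_iff.mp (hC i hi)).2
    _ = C ^ 2 := by
        rw [sum_const, nsmul_eq_mul, inv_mul_cancel_left₀ hcard.ne']

/-- The average of `ε * H (ε * x)` over the sign sequences `ε` that are `1` off `F`. -/
noncomputable def signAverage (H : (ℕ → ℝ) → ℕ → ℝ) (F : Finset ℕ) (x : ℕ → ℝ) (n : ℕ) : ℝ :=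
  (F.powerset.card : ℝ)⁻¹ * ∑ S ∈ F.powerset, signOf S n * H (signOf S * x) n

theorem signAverage_insert (H : (ℕ → ℝ) → ℕ → ℝ) {F : Finset ℕ} {a n : ℕ} (ha : a ∉ F)
    {x : ℕ → ℝ} (hx : x a = 0) (hn : n ≠ a) :
    signAverage H (insert a F) x n = signAverage H F x n := by
  have key : ∀ S ∈ F.powerset, signOf (insert a S) n * H (signOf (insert a S) * x) n
      = signOf S n * H (signOf S * x) n := by
    intro S _
    have h1 : signOf (insert a S) n = signOf S n := by simp [signOf, hn]
    have h2 : signOf (insert a S) * x = signOf S * x := by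
      ext m
      by_cases hm : m = a
      · subst hm; simp [hx]
      · simp [signOf, hm]
    rw [h1, h2]
  unfold signAverage
  rw [sum_powerset_insert ha, sum_congr rfl key, card_powerset, card_powerset,
    card_insert_of_notMem ha, pow_succ]
  push_cast
  field_simp
  ring

theorem signAverage_eq_of_subset (H : (ℕ → ℝ) → ℕ → ℝ) {F G : Finset ℕ} (hFG : F ⊆ G)
    {x : ℕ → ℝ} (hx : ∀ m, m ∉ F → x m = 0) {n : ℕ} (hn : n ∈ F) :
    signAverage H G x n = signAverage H F x n := by
  have h : ∀ E : Finset ℕ, Disjoint E F → signAverage H (E ∪ F) x n = signAverage H F x n := by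
    intro E
    induction E using Finset.induction_on with
    | empty => simp
    | insert a E ha ih =>
      intro hd
      rw [disjoint_insert_left] at hd
      rw [insert_union, signAverage_insert H (by simp [ha, hd.1]) (hx a hd.1)
        (fun h => hd.1 (h ▸ hn)), ih hd.2]
  rw [← h (G \ F) sdiff_disjoint, sdiff_union_of_subset hFG]

theorem signAverage_sign_mul (H : (ℕ → ℝ) → ℕ → ℝ) {F : Finset ℕ} {x : ℕ → ℝ}
    (hx : ∀ m, m ∉ F → x m = 0) {ε : ℕ → ℝ} (hε : IsSign ε) {n : ℕ} (hn : n ∈ F) :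
    signAverage H F (ε * x) n = ε n * signAverage H F x n := by
  classical
  set D : Finset ℕ := F.filter fun m => ε m = -1 with hD
  have hsign : ∀ S : Finset ℕ, ∀ m ∈ F, signOf (symmDiff S D) m = signOf S m * ε m := by
    intro S m hm
    rcases hε m with h | h <;> by_cases hS : m ∈ S <;>
      norm_num [signOf, mem_symmDiff, hD, hm, h, hS]
  have hmaps : ∀ S ∈ F.powerset, symmDiff S D ∈ F.powerset := by
    intro S hS
    rw [mem_powerset] at hS ⊢
    intro m hm
    rcases mem_symmDiff.mp hm with h | h
    · exact hS h.1
    · exact filter_subset _ _ h.1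
  unfold signAverage
  rw [mul_left_comm]
  congr 1
  rw [mul_sum]
  refine sum_nbij' (fun S => symmDiff S D) (fun S => symmDiff S D) hmaps hmaps
    (fun S _ => symmDiff_symmDiff_cancel_right D S)
    (fun S _ => symmDiff_symmDiff_cancel_right D S) ?_
  intro S _
  have hmul : signOf (symmDiff S D) * x = signOf S * (ε * x) := by
    ext m
    by_cases hm : m ∈ F
    · simp [hsign S m hm, mul_assoc]
    · simp [hx m hm]
  rw [hmul, hsign S n hn]
  linear_combination (-signOf S n * H (signOf S * (ε * x)) n) * hε.mul_self n

theorem signAverage_smul {H : (ℕ → ℝ) → ℕ → ℝ}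
    (hH : ∀ (c : ℝ) (x : ℕ → ℝ), FinSupp x → H (c • x) = c • H x) (F : Finset ℕ) (c : ℝ)
    {x : ℕ → ℝ} (hx : FinSupp x) (n : ℕ) :
    signAverage H F (c • x) n = c * signAverage H F x n := by
  unfold signAverage
  rw [mul_left_comm]
  congr 1
  rw [mul_sum]
  refine sum_congr rfl fun S _ => ?_
  rw [mul_smul_comm, hH c _ (hx.mul_left _), Pi.smul_apply, smul_eq_mul, mul_left_comm]

open Classical in
/-- The symmetrization of `H`: the average of `ε * H (ε * x)` over the signs on `supp x`. -/
noncomputable def symmetrization (H : (ℕ → ℝ) → ℕ → ℝ) (x : ℕ → ℝ) (n : ℕ) : ℝ :=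
  if h : FinSupp x then if x n = 0 then 0 else signAverage H h.toFinset x n else 0

theorem symmetrization_apply_eq_zero (H : (ℕ → ℝ) → ℕ → ℝ) {x : ℕ → ℝ} {n : ℕ}
    (hn : x n = 0) : symmetrization H x n = 0 := by
  simp [symmetrization, hn]

theorem symmetrization_eq_signAverage (H : (ℕ → ℝ) → ℕ → ℝ) {F : Finset ℕ} {x : ℕ → ℝ}
    (hx : FinSupp x) (hF : ∀ m, m ∉ F → x m = 0) {n : ℕ} (hn : n ∈ F) :
    symmetrization H x n = signAverage H F x n := by
  by_cases h0 : x n = 0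
  · rw [symmetrization_apply_eq_zero H h0]
    have hfix : signOf {n} * x = x := by
      ext m
      by_cases hm : m = n
      · subst hm; simp [h0]
      · simp [signOf, hm]
    have h := signAverage_sign_mul H hF (isSign_signOf {n}) hn
    rw [hfix] at h
    simp only [signOf, mem_singleton, if_true] at h
    linarith
  · rw [symmetrization, dif_pos hx, if_neg h0]
    refine (signAverage_eq_of_subset H (fun m hm => ?_) (fun m hm => ?_) ?_).symm
    · by_contra hmF
      exact (hx.mem_toFinset.mp hm) (hF m hmF)
    · by_contra h
      exact hm (hx.mem_toFinset.mpr h)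
    · exact hx.mem_toFinset.mpr h0

/-- Let `Ψ, Φ : c00 → c00` be homogeneous maps commuting with all sign
sequences. If there are a homogeneous map `H : c00 → ℓ₂` and a constant `K` with
`‖H(x+x') − H(x) − H(x') − Φ(Ψ(x+x') − Ψ(x) − Ψ(x'))‖₂ ≤ K(‖x‖₂ + ‖x'‖₂)` on `c00`,
then there is a homogeneous map `H̃ : c00 → ℓ₂` commuting with all sign sequences (in
particular support-preserving) satisfying the same inequality with the same constant. -/
theorem witness_can_be_symmetrized
    (Ψ Φ : (ℕ → ℝ) → (ℕ → ℝ))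
    (hΨ_c00 : ∀ x, FinSupp x → FinSupp (Ψ x))
    (hΦ_c00 : ∀ x, FinSupp x → FinSupp (Φ x))
    (hΨ_homog : ∀ (c : ℝ) (x : ℕ → ℝ), FinSupp x → Ψ (c • x) = c • Ψ x)
    (hΦ_homog : ∀ (c : ℝ) (x : ℕ → ℝ), FinSupp x → Φ (c • x) = c • Φ x)
    (hΨ_sign : ∀ (ε x : ℕ → ℝ), IsSign ε → FinSupp x → Ψ (ε * x) = ε * Ψ x)
    (hΦ_sign : ∀ (ε x : ℕ → ℝ), IsSign ε → FinSupp x → Φ (ε * x) = ε * Φ x)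
    (H : (ℕ → ℝ) → (ℕ → ℝ))
    (hH_l2 : ∀ x, FinSupp x → Summable (fun n => (H x n) ^ 2))
    (hH_homog : ∀ (c : ℝ) (x : ℕ → ℝ), FinSupp x → H (c • x) = c • H x)
    (K : ℝ)
    (hK : ∀ x x' : ℕ → ℝ, FinSupp x → FinSupp x' →
      l2Norm (fun n => H (x + x') n - H x n - H x' n
          - Φ (Ψ (x + x') - Ψ x - Ψ x') n)
        ≤ K * (l2Norm x + l2Norm x')) :
    ∃ H' : (ℕ → ℝ) → (ℕ → ℝ),
      (∀ x, FinSupp x → Summable (fun n => (H' x n) ^ 2)) ∧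
      (∀ (c : ℝ) (x : ℕ → ℝ), FinSupp x → H' (c • x) = c • H' x) ∧
      (∀ (ε x : ℕ → ℝ), IsSign ε → FinSupp x → H' (ε * x) = ε * H' x) ∧
      (∀ x : ℕ → ℝ, FinSupp x → ∀ n, x n = 0 → H' x n = 0) ∧
      (∀ x x' : ℕ → ℝ, FinSupp x → FinSupp x' →
        l2Norm (fun n => H' (x + x') n - H' x n - H' x' n
            - Φ (Ψ (x + x') - Ψ x - Ψ x') n)
          ≤ K * (l2Norm x + l2Norm x')) := by
  have hcover : ∀ {x : ℕ → ℝ} (hx : FinSupp x), ∀ m, m ∉ hx.toFinset → x m = 0 := by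
    intro x hx m hm
    by_contra h
    exact hm (hx.mem_toFinset.mpr h)
  refine ⟨symmetrization H, fun x hx => ?_, fun c x hx => ?_, fun ε x hε hx => ?_,
    fun x _ n hn => symmetrization_apply_eq_zero H hn, fun x x' hx hx' => ?_⟩
  · exact FinSupp.summable_sq
      (hx.subset fun n hn h => hn (symmetrization_apply_eq_zero H h))
  · ext n
    rw [Pi.smul_apply, smul_eq_mul]
    by_cases hn : n ∈ hx.toFinset
    · rw [symmetrization_eq_signAverage H (hx.const_smul c)
        (fun m hm => by simp [hcover hx m hm]) hn,
        symmetrization_eq_signAverage H hx (hcover hx) hn, signAverage_smul hH_homog _ c hx]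
    · have h0 := hcover hx n hn
      rw [symmetrization_apply_eq_zero H h0, symmetrization_apply_eq_zero H (by simp [h0]),
        mul_zero]
  · ext n
    rw [Pi.mul_apply]
    by_cases hn : n ∈ hx.toFinset
    · rw [symmetrization_eq_signAverage H (hx.mul_left ε)
        (fun m hm => by simp [hcover hx m hm]) hn,
        symmetrization_eq_signAverage H hx (hcover hx) hn,
        signAverage_sign_mul H (hcover hx) hε hn]
    · have h0 := hcover hx n hn
      rw [symmetrization_apply_eq_zero H h0, symmetrization_apply_eq_zero H (by simp [h0]),
        mul_zero]
  · set F : Finset ℕ := hx.toFinset ∪ hx'.toFinset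
    have hF : ∀ m, m ∉ F → x m = 0 := fun m hm => hcover hx m fun h => hm (mem_union_left _ h)
    have hF' : ∀ m, m ∉ F → x' m = 0 := fun m hm =>
      hcover hx' m fun h => hm (mem_union_right _ h)
    have hFadd : ∀ m, m ∉ F → (x + x') m = 0 := fun m hm => by simp [hF m hm, hF' m hm]
    set u := Ψ (x + x') - Ψ x - Ψ x' with hu
    have hu_fin : FinSupp u :=
      ((hΨ_c00 _ (hx.add hx')).sub (hΨ_c00 _ hx)).sub (hΨ_c00 _ hx')
    set f : Finset ℕ → ℕ → ℝ := fun S => signOf S * fun n =>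
      H (signOf S * x + signOf S * x') n - H (signOf S * x) n - H (signOf S * x') n
        - Φ (Ψ (signOf S * x + signOf S * x') - Ψ (signOf S * x) - Ψ (signOf S * x')) n with hf
    refine l2Norm_le_of_abs_le_average F.powerset (powerset_nonempty F) f _ _
      (fun S _ => ?_) (fun S _ => ?_) (fun n => ?_)
    · have hy := hx.mul_left (signOf S)
      have hy' := hx'.mul_left (signOf S)
      simp only [hf, Pi.mul_apply, mul_pow, (isSign_signOf S).sq, one_mul]
      exact summable_sq_sub (summable_sq_sub (summable_sq_sub (hH_l2 _ (hy.add hy'))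
        (hH_l2 _ hy)) (hH_l2 _ hy')) (hΦ_c00 _
          (((hΨ_c00 _ (hy.add hy')).sub (hΨ_c00 _ hy)).sub (hΨ_c00 _ hy'))).summable_sq
    · rw [hf, l2Norm_sign_mul (isSign_signOf S)]
      refine (hK _ _ (hx.mul_left _) (hx'.mul_left _)).trans_eq ?_
      rw [l2Norm_sign_mul (isSign_signOf S), l2Norm_sign_mul (isSign_signOf S)]
    · by_cases hn : n ∈ F
      · refine (congrArg abs ?_).le
        rw [symmetrization_eq_signAverage H (hx.add hx') hFadd hn,
          symmetrization_eq_signAverage H hx hF hn, symmetrization_eq_signAverage H hx' hF' hn]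
        have hterm : ∀ S ∈ F.powerset, f S n
            = signOf S n * H (signOf S * (x + x')) n - signOf S n * H (signOf S * x) n
              - signOf S n * H (signOf S * x') n - Φ u n := by
          intro S _
          have hS := isSign_signOf S
          have hΨu : Ψ (signOf S * (x + x')) - Ψ (signOf S * x) - Ψ (signOf S * x')
              = signOf S * u := by
            rw [hΨ_sign _ _ hS (hx.add hx'), hΨ_sign _ _ hS hx, hΨ_sign _ _ hS hx', hu,
              mul_sub, mul_sub]
          simp only [hf, Pi.mul_apply, ← mul_add]
          rw [hΨu, hΦ_sign _ _ hS hu_fin, Pi.mul_apply]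
          linear_combination (-Φ u n) * hS.mul_self n
        have hcard : (F.powerset.card : ℝ) ≠ 0 := by
          exact_mod_cast (powerset_nonempty F).card_pos.ne'
        rw [sum_congr rfl hterm]
        simp only [sum_sub_distrib, mul_sub, sum_const, nsmul_eq_mul, signAverage]
        rw [inv_mul_cancel_left₀ hcard]
      · have hun : u n = 0 := by
          simp [hu, apply_eq_zero_of_sign_equivariant hΨ_sign (hx.add hx') (hFadd n hn),
            apply_eq_zero_of_sign_equivariant hΨ_sign hx (hF n hn),
            apply_eq_zero_of_sign_equivariant hΨ_sign hx' (hF' n hn)]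
        rw [symmetrization_apply_eq_zero H (hFadd n hn),
          symmetrization_apply_eq_zero H (hF n hn), symmetrization_apply_eq_zero H (hF' n hn),
          apply_eq_zero_of_sign_equivariant hΦ_sign hu_fin hun]
        simp
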